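/- arXiv:2405.20935 — 8 statements merged into one kernel-verified Lean document; each statement's English description precedes it below -/
import Mathlib

section
/- Let n, m, N, M be positive integers with m ≥ 2, N ≤ M and M dividing n. Let q be the max-scaled INT_m quantization on ℝⁿ, let x ∈ ℝⁿ, let P be an N:M magnitude sparsity mask for x with associated sparsification s, and let p ∈ [1, ∞). Then applying sparsity before quantization introduces no additional error: ‖x − q(s(x))‖_p ≤ ‖x − q(x)‖_p + ‖x − s(x)‖_p. -/
/-- Max-scaled INT_m quantization on ℝⁿ: `q(x)_i = δ(x) * round (x_i / δ(x))` where
`δ(x) = (max_j |x_j|) / (2^(m-1) - 1)`. (For `x = 0` this yields `q 0 = 0`.) -/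
noncomputable def qInt (m : ℕ) {n : ℕ} (x : Fin n → ℝ) : Fin n → ℝ :=
  fun i =>
    let δ : ℝ := (⨆ j, |x j|) / ((2 : ℝ) ^ (m - 1) - 1)
    δ * (round (x i / δ) : ℝ)

/-- `P` is an N:M magnitude sparsity mask for `v`: each consecutive group of `M`
coordinates (indices with a common value of `i / M`) contains exactly `M - N` pruned
indices, and within each group every pruned coordinate has magnitude at most that of
every retained coordinate. -/
def IsNMMask {n : ℕ} (N M : ℕ) (v : Fin n → ℝ) (P : Finset (Fin n)) : Prop :=
  (∀ g : ℕ, g < n / M → (P.filter fun i : Fin n => (i : ℕ) / M = g).card = M - N) ∧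
  (∀ i ∈ P, ∀ j : Fin n, j ∉ P → (i : ℕ) / M = (j : ℕ) / M → |v i| ≤ |v j|)

/-- Sparsification associated with a mask `P`: coordinates in `P` are set to `0`,
the others are left unchanged. -/
def sparsify {n : ℕ} (P : Finset (Fin n)) (v : Fin n → ℝ) : Fin n → ℝ :=
  fun i => if i ∈ P then 0 else v i

/-- The `L_p` norm `(∑ i, |v i| ^ p) ^ (1/p)` on `ℝⁿ`. -/
noncomputable def lpNorm {n : ℕ} (p : ℝ) (v : Fin n → ℝ) : ℝ :=
  (∑ i, |v i| ^ p) ^ (1 / p)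

theorem exists_retained {n N M : ℕ} (hN : 0 < N) (hNM : N ≤ M) (hMdvd : M ∣ n)
    (x : Fin n → ℝ) (P : Finset (Fin n)) (hP : IsNMMask N M x P) (j : Fin n) :
    ∃ k, |x j| ≤ |sparsify P x k| := by
  by_cases hj : j ∈ P
  · have hM : 0 < M := by omega
    obtain ⟨c, hc⟩ := hMdvd
    have hnM : n / M = c := Nat.div_eq_of_eq_mul_right hM hc
    have hg : (j : ℕ) / M < n / M := by
      rw [hnM]
      apply Nat.div_lt_of_lt_mul
      exact lt_of_lt_of_eq j.2 hc
    have hcard := hP.1 _ hg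
    have key : ∃ k : Fin n, k ∉ P ∧ (k : ℕ) / M = (j : ℕ) / M := by
      by_contra! hcon
      have hlt : ∀ r : Fin M, M * ((j : ℕ) / M) + (r : ℕ) < n := by
        intro r
        have h1 : (j : ℕ) / M < c := by
          rwa [hnM] at hg
        have h2 : M * ((j : ℕ) / M + 1) ≤ M * c := Nat.mul_le_mul_left _ h1
        have := r.2
        rw [Nat.mul_add] at h2
        omega
      have hle : (Finset.univ : Finset (Fin M)).card ≤
          (P.filter fun i : Fin n => (i : ℕ) / M = (j : ℕ) / M).card := by
        apply Finset.card_le_card_of_injOn (fun r => (⟨_, hlt r⟩ : Fin n))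
        · intro r _
          have hdiv : (M * ((j : ℕ) / M) + (r : ℕ)) / M = (j : ℕ) / M := by
            rw [Nat.mul_add_div hM, Nat.div_eq_of_lt r.2, Nat.add_zero]
          simp only [Finset.coe_filter, Set.mem_ofPred_eq]
          refine ⟨?_, hdiv⟩
          by_contra hnot
          exact hcon _ hnot hdiv
        · intro a _ b _ hab
          simp only [Fin.mk.injEq] at hab
          exact Fin.ext (by omega)
      rw [hcard, Finset.card_univ, Fintype.card_fin] at hle
      omega
    obtain ⟨k, hk, hkj⟩ := key
    exact ⟨k, by simpa [sparsify, hk] using hP.2 j hj k hk hkj.symm⟩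
  · exact ⟨j, by simp [sparsify, hj]⟩

theorem sup_sparsify {n N M : ℕ} (hn : 0 < n) (hN : 0 < N) (hNM : N ≤ M) (hMdvd : M ∣ n)
    (x : Fin n → ℝ) (P : Finset (Fin n)) (hP : IsNMMask N M x P) :
    (⨆ j, |sparsify P x j|) = ⨆ j, |x j| := by
  haveI : Nonempty (Fin n) := ⟨⟨0, hn⟩⟩
  apply le_antisymm
  · apply ciSup_mono (Set.finite_range _).bddAbove
    intro j
    by_cases hj : j ∈ P <;> simp [sparsify, hj]
  · apply ciSup_le
    intro j
    obtain ⟨k, hk⟩ := exists_retained hN hNM hMdvd x P hP j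
    exact hk.trans (le_ciSup (f := fun j => |sparsify P x j|) (Set.finite_range _).bddAbove k)

/-- Applying sparsity before quantization introduces no additional error:
`‖x − q(s(x))‖_p ≤ ‖x − q(x)‖_p + ‖x − s(x)‖_p`. -/
theorem sparsity_before_quantization_no_additional_error
    (n m N M : ℕ) (hn : 0 < n) (hm : 2 ≤ m) (hN : 0 < N) (hNM : N ≤ M) (hMdvd : M ∣ n)
    (x : Fin n → ℝ) (P : Finset (Fin n)) (hP : IsNMMask N M x P)
    (p : ℝ) (hp : 1 ≤ p) :
    lpNorm p (x - qInt m (sparsify P x)) ≤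
      lpNorm p (x - qInt m x) + lpNorm p (x - sparsify P x) := by
  have hsup := sup_sparsify hn hN hNM hMdvd x P hP
  have hle : ∀ i, |(x - qInt m (sparsify P x)) i| ≤
      abs (|(x - qInt m x) i| + |(x - sparsify P x) i|) := by
    intro i
    rw [abs_of_nonneg (by positivity : 0 ≤ |(x - qInt m x) i| + |(x - sparsify P x) i|)]
    by_cases hi : i ∈ P
    · simp [qInt, sparsify, hi]
    · have : qInt m (sparsify P x) i = qInt m x i := by
        simp only [qInt, hsup]
        simp [sparsify, hi]
      simp [this]
  have hmink := Real.Lp_add_le Finset.univ (fun i => |(x - qInt m x) i|)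
    (fun i => |(x - sparsify P x) i|) hp
  simp only [abs_abs] at hmink
  refine le_trans ?_ hmink
  unfold lpNorm
  have hp0 : 0 ≤ p := by linarith
  refine Real.rpow_le_rpow (Finset.sum_nonneg fun i _ => by positivity) ?_ (by positivity)
  exact Finset.sum_le_sum fun i _ => Real.rpow_le_rpow (abs_nonneg _) (hle i) hp0
end

section
/- Let n, N, M be positive integers with N ≤ M and M dividing n, let x ∈ ℝⁿ, and let P be an N:M magnitude sparsity mask for x with associated sparsification s. Then magnitude-based sparsification preserves the maximal magnitude of the block: max_{1≤i≤n} |s(x)_i| = max_{1≤i≤n} |x_i|. Consequently the scale parameter of any max-scaled quantization is unchanged by the sparsification. -/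
/-- Magnitude-based sparsification preserves the maximal magnitude of the block. -/
theorem sparsify_preserves_maxAbs
    (n N M : ℕ) (hn : 0 < n) (hN : 0 < N) (hNM : N ≤ M) (hMdvd : M ∣ n)
    (x : Fin n → ℝ) (P : Finset (Fin n)) (hP : IsNMMask N M x P) :
    (⨆ i, |sparsify P x i|) = ⨆ i, |x i| := by
  have : Nonempty (Fin n) := ⟨⟨0, hn⟩⟩
  obtain ⟨h1, h2⟩ := hP
  have hM : 0 < M := by omega
  have key : ∀ i ∈ P, ∃ j : Fin n, j ∉ P ∧ (i : ℕ) / M = (j : ℕ) / M := by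
    intro i _
    by_contra! hcon
    have hg : (i : ℕ) / M < n / M := Nat.div_lt_div_of_lt_of_dvd hMdvd i.2
    have hc := h1 _ hg
    obtain ⟨k, rfl⟩ := hMdvd
    rw [Nat.mul_div_cancel_left _ hM] at hg
    have hb : ∀ t : Fin M, M * ((i : ℕ) / M) + t < M * k := by
      intro t
      have h3 : M * ((i : ℕ) / M + 1) ≤ M * k := Nat.mul_le_mul_left M hg
      have := t.2
      rw [mul_add] at h3
      omega
    have hd : ∀ t : Fin M, (M * ((i : ℕ) / M) + t) / M = (i : ℕ) / M := by
      intro t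
      rw [Nat.mul_add_div hM, Nat.div_eq_of_lt t.2, add_zero]
    have hle : (Finset.univ : Finset (Fin M)).card ≤
        (P.filter fun j : Fin (M * k) => (j : ℕ) / M = (i : ℕ) / M).card := by
      apply Finset.card_le_card_of_injOn (fun t : Fin M => (⟨M * ((i : ℕ) / M) + t, hb t⟩ : Fin (M * k)))
      · intro t _
        have hmem : (⟨M * ((i : ℕ) / M) + t, hb t⟩ : Fin (M * k)) ∈ P := by
          by_contra hn'
          exact hcon _ hn' (hd t).symm
        exact Finset.mem_coe.2 (Finset.mem_filter.2 ⟨hmem, hd t⟩)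
      · intro a _ b _ hab
        have := congrArg Fin.val hab
        apply Fin.ext
        simp only at this
        omega
    rw [hc, Finset.card_univ, Fintype.card_fin] at hle
    omega
  apply le_antisymm
  · apply ciSup_le
    intro i
    refine le_trans ?_ (le_ciSup (Set.finite_range fun i => |x i|).bddAbove i)
    unfold sparsify
    split_ifs <;> simp
  · apply ciSup_le
    intro i
    have hbd := (Set.finite_range fun i => |sparsify P x i|).bddAbove
    by_cases hi : i ∈ P
    · obtain ⟨j, hj, hij⟩ := key i hi
      refine le_trans ((h2 i hi j hj hij).trans ?_) (le_ciSup hbd j)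
      simp [sparsify, hj]
    · refine le_trans ?_ (le_ciSup hbd i)
      simp [sparsify, hi]
end

section
/- Let q be the max-scaled INT_4 quantization on ℝ² and let x = (3.9, 4.0). Then q(x) = (4.0, 4.0); the set {2} (pruning the second coordinate) is a valid 1:2 magnitude sparsity mask for the quantized vector q(x), and the resulting sparsified quantized vector is (4.0, 0); the unique 1:2 magnitude sparsification s of x itself is s(x) = (0, 4.0); and for every p ∈ [1, ∞) the strict inequality ‖x − (4.0, 0)‖_p > ‖x − q(x)‖_p + ‖x − s(x)‖_p holds (the left side is (0.1^p + 4^p)^{1/p} > 4 and the right side is 0.1 + 3.9 = 4). Hence applying quantization before magnitude-based sparsity may introduce additional error. -/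
theorem sup_aux : (⨆ j, |(![3.9, 4.0] : Fin 2 → ℝ) j|) = 4 := by
  apply le_antisymm
  · apply ciSup_le
    intro j
    fin_cases j <;> norm_num [abs_le]
  · have := le_ciSup (f := fun j => |(![3.9, 4.0] : Fin 2 → ℝ) j|) (Set.finite_range _).bddAbove 1
    refine le_trans ?_ this
    norm_num

theorem q_aux : qInt 4 (![3.9, 4.0] : Fin 2 → ℝ) = ![4.0, 4.0] := by
  have h1 : round ((3.9 : ℝ) / (4 / (2 ^ (4 - 1) - 1))) = 7 := by
    rw [round_eq, Int.floor_eq_iff]; norm_num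
  have h2 : round ((4.0 : ℝ) / (4 / (2 ^ (4 - 1) - 1))) = 7 := by
    rw [round_eq, Int.floor_eq_iff]; norm_num
  funext i
  unfold qInt
  simp only [sup_aux]
  fin_cases i
  · show (4 : ℝ) / (2 ^ (4 - 1) - 1) * (round ((3.9 : ℝ) / (4 / (2 ^ (4 - 1) - 1))) : ℝ) = 4.0
    rw [h1]; norm_num
  · show (4 : ℝ) / (2 ^ (4 - 1) - 1) * (round ((4.0 : ℝ) / (4 / (2 ^ (4 - 1) - 1))) : ℝ) = 4.0
    rw [h2]; norm_num

theorem lp_single0 (p a : ℝ) (hp : 1 ≤ p) (ha : 0 ≤ a) (v : Fin 2 → ℝ)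
    (h0 : |v 0| = a) (h1 : v 1 = 0) : lpNorm p v = a := by
  have hp0 : p ≠ 0 := by linarith
  unfold lpNorm
  rw [Fin.sum_univ_two, h0, h1, abs_zero, Real.zero_rpow hp0, add_zero, one_div,
    Real.rpow_rpow_inv ha hp0]

theorem lp_gt (p : ℝ) (hp : 1 ≤ p) (v : Fin 2 → ℝ)
    (h0 : 0 < |v 0|) (h1 : |v 1| = 4) : 4 < lpNorm p v := by
  have hp0 : p ≠ 0 := by linarith
  unfold lpNorm
  rw [Fin.sum_univ_two, h1, one_div]
  have h := Real.rpow_pos_of_pos h0 p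
  calc (4 : ℝ) = ((4 : ℝ) ^ p) ^ p⁻¹ := (Real.rpow_rpow_inv (by norm_num) hp0).symm
    _ < _ := Real.rpow_lt_rpow (by positivity) (by linarith) (by positivity)

/-- For `x = (3.9, 4.0)` and max-scaled INT₄ quantization `q`: `q(x) = (4, 4)`;
pruning the second coordinate is a valid 1:2 magnitude sparsity mask for `q(x)`,
yielding `(4, 0)`; the unique 1:2 magnitude sparsification of `x` is `(0, 4)`;
and for every `p ∈ [1, ∞)` the error of quantization-then-sparsity strictly exceeds
the sum of the individual errors. -/
theorem quantization_before_sparsity_may_add_error :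
    let x : Fin 2 → ℝ := ![3.9, 4.0]
    qInt 4 x = ![4.0, 4.0] ∧
    IsNMMask 1 2 (qInt 4 x) ({1} : Finset (Fin 2)) ∧
    sparsify ({1} : Finset (Fin 2)) (qInt 4 x) = ![4.0, 0] ∧
    (∀ P : Finset (Fin 2), IsNMMask 1 2 x P → sparsify P x = ![0, 4.0]) ∧
    (∀ p : ℝ, 1 ≤ p →
      lpNorm p (x - ![(4.0 : ℝ), 0]) >
        lpNorm p (x - qInt 4 x) + lpNorm p (x - ![(0 : ℝ), 4.0])) := by
  intro x
  have hq : qInt 4 x = ![4.0, 4.0] := q_aux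
  rw [hq]
  refine ⟨rfl, ⟨?_, ?_⟩, ?_, ?_, ?_⟩
  · intro g hg
    have : g = 0 := by omega
    subst this
    decide
  · intro i _ j _ _
    fin_cases i <;> fin_cases j <;> simp
  · funext i
    fin_cases i <;> simp [sparsify]
  · rintro P ⟨hc, hm⟩
    have hc := hc 0 (by norm_num)
    have key : (0 : Fin 2) ∈ P ∧ (1 : Fin 2) ∉ P := by
      have hd : ∀ P : Finset (Fin 2),
          (P.filter fun i : Fin 2 => (i : ℕ) / 2 = 0).card = 2 - 1 →
          ((0 : Fin 2) ∈ P ∧ (1 : Fin 2) ∉ P) ∨ ((1 : Fin 2) ∈ P ∧ (0 : Fin 2) ∉ P) := by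
        decide
      rcases hd P hc with h | ⟨h1, h0⟩
      · exact h
      · have := hm 1 h1 0 h0 (by norm_num)
        norm_num [x, abs_of_pos] at this
    funext i
    fin_cases i <;> simp [sparsify, key.1, key.2, x]
  · intro p hp
    rw [lp_single0 p 0.1 hp (by norm_num) (x - ![4.0, 4.0]) (by norm_num [x, abs_of_neg])
        (by norm_num [x]),
      lp_single0 p 3.9 hp (by norm_num) (x - ![0, 4.0]) (by norm_num [x, abs_of_pos])
        (by norm_num [x])]
    have := lp_gt p hp (x - ![4.0, 0]) (by norm_num [x]) (by norm_num [x])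
    norm_num at this ⊢
    exact this
end

section
/- Let n, m, N, M be positive integers with m ≥ 2, N ≤ M and M dividing n. Let q be the max-scaled INT_m quantization on ℝⁿ, let x ∈ ℝⁿ, and let step ≥ 0 satisfy |x_i − q(x)_i| ≤ step for all indices i. Let P_q be any N:M magnitude sparsity mask for q(x) with associated sparsification s_q, and let P be any N:M magnitude sparsity mask for x with associated sparsification s. Then the error of quantization followed by sparsity obeys the L₁ upper bound ‖x − s_q(q(x))‖₁ ≤ ‖x − q(x)‖₁ + ‖x − s(x)‖₁ + 2·step·((M − N)/M)·n. -/
theorem aux_swap {ι : Type*} [DecidableEq ι] (A B : Finset ι) (f : ι → ℝ)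
    (hc : A.card = B.card) (h : ∀ a ∈ A, ∀ b ∈ B, b ∉ A → f a ≤ f b) :
    ∑ i ∈ A, f i ≤ ∑ i ∈ B, f i := by
  have hc' : (A \ B).card = (B \ A).card := Finset.card_sdiff_comm hc
  have h1 : ∑ i ∈ A \ B, f i ≤ ∑ i ∈ B \ A, f i := by
    let e := Finset.equivOfCardEq hc'
    rw [← Finset.sum_coe_sort (A \ B), ← Finset.sum_coe_sort (B \ A), ← Equiv.sum_comp e]
    apply Finset.sum_le_sum
    intro i _
    have ha := Finset.mem_sdiff.1 i.2
    have hb := Finset.mem_sdiff.1 (e i).2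
    exact h _ ha.1 _ hb.1 hb.2
  have h2 := Finset.sum_inter_add_sum_sdiff A B f
  have h3 := Finset.sum_inter_add_sum_sdiff B A f
  rw [Finset.inter_comm] at h3
  linarith

theorem aux_maps {n M : ℕ} (hM : 0 < M) (hMdvd : M ∣ n) (P : Finset (Fin n)) :
    ∀ i ∈ P, (i : ℕ) / M ∈ Finset.range (n / M) := by
  intro i _
  rw [Finset.mem_range]
  exact Nat.div_lt_div_of_lt_of_dvd hMdvd i.2

theorem aux_lp {n : ℕ} (v : Fin n → ℝ) : lpNorm 1 v = ∑ i, |v i| := by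
  simp [lpNorm]

/-- L₁ upper bound for the error of quantization followed by sparsity:
`‖x − s_q(q(x))‖₁ ≤ ‖x − q(x)‖₁ + ‖x − s(x)‖₁ + 2⋅step⋅((M−N)/M)⋅n`. -/
theorem quantize_then_sparsify_L1_upper_bound
    (n m N M : ℕ) (hn : 0 < n) (hm : 2 ≤ m) (hN : 0 < N) (hNM : N ≤ M) (hMdvd : M ∣ n)
    (x : Fin n → ℝ) (step : ℝ) (hstep : 0 ≤ step)
    (hq : ∀ i, |x i - qInt m x i| ≤ step)
    (Pq : Finset (Fin n)) (hPq : IsNMMask N M (qInt m x) Pq)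
    (P : Finset (Fin n)) (hP : IsNMMask N M x P) :
    lpNorm 1 (x - sparsify Pq (qInt m x)) ≤
      lpNorm 1 (x - qInt m x) + lpNorm 1 (x - sparsify P x) +
        2 * step * (((M : ℝ) - N) / M) * n := by
  have hM : 0 < M := by omega
  generalize qInt m x = q at *
  simp only [aux_lp, Pi.sub_apply]
  have hmin : ∑ i ∈ Pq, |q i| ≤ ∑ i ∈ P, |q i| := by
    rw [← Finset.sum_fiberwise_of_maps_to (aux_maps hM hMdvd Pq),
      ← Finset.sum_fiberwise_of_maps_to (aux_maps hM hMdvd P)]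
    apply Finset.sum_le_sum
    intro g hg
    rw [Finset.mem_range] at hg
    apply aux_swap _ _ (fun i => |q i|) (by rw [hPq.1 g hg, hP.1 g hg])
    intro a ha b hb hba
    simp only [Finset.mem_filter] at ha hb hba
    exact hPq.2 a ha.1 b (fun hh => hba ⟨hh, hb.2⟩) (by rw [ha.2, hb.2])
  have hcard : (P.card : ℝ) = ((M : ℝ) - N) / M * n := by
    have h1 := Finset.card_eq_sum_card_fiberwise (aux_maps hM hMdvd P)
    rw [Finset.sum_congr rfl (fun g hg => hP.1 g (Finset.mem_range.1 hg))] at h1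
    rw [h1]
    obtain ⟨k, rfl⟩ := hMdvd
    have : (M : ℝ) ≠ 0 := by positivity
    simp [Nat.mul_div_cancel_left k hM, Nat.cast_sub hNM]
    field_simp
  have hPx : ∑ i, |x i - sparsify P x i| = ∑ i ∈ P, |x i| := by
    rw [← Finset.sum_filter_add_sum_filter_not Finset.univ (fun i => i ∈ P)]
    rw [Finset.filter_univ_mem]
    rw [Finset.sum_congr rfl (g := fun i => |x i|) (by intro i hi; simp [sparsify, hi])]
    rw [Finset.sum_eq_zero (s := Finset.filter _ _)
      (by intro i hi; simp at hi; simp [sparsify, hi])]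
    simp
  have hL : ∑ i, |x i - sparsify Pq q i| ≤ ∑ i, |x i - q i| + ∑ i ∈ Pq, |q i| := by
    have : ∑ i ∈ Pq, |q i| = ∑ i, if i ∈ Pq then |q i| else 0 := by simp
    rw [this, ← Finset.sum_add_distrib]
    apply Finset.sum_le_sum
    intro i _
    by_cases hi : i ∈ Pq
    · simp only [sparsify, hi, if_true, sub_zero]
      have := abs_add_le (x i - q i) (q i)
      simpa using this
    · simp [sparsify, hi]
  have hR : ∑ i ∈ P, |q i| ≤ ∑ i ∈ P, |x i| + P.card * step := by
    rw [← nsmul_eq_mul, ← Finset.sum_const, ← Finset.sum_add_distrib]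
    apply Finset.sum_le_sum
    intro i _
    have h1 := abs_sub_abs_le_abs_sub (q i) (x i)
    have h2 := hq i
    rw [abs_sub_comm] at h2
    linarith
  have h0 : 0 ≤ (P.card : ℝ) * step := by positivity
  rw [hPx, mul_assoc, ← hcard]
  nlinarith
end

section
/- Let n, m, N, M be positive integers with m ≥ 2, N ≤ M and M dividing n, and let p ∈ [1, ∞). Let q be the max-scaled INT_m quantization on ℝⁿ, let x ∈ ℝⁿ, and let step ≥ 0 satisfy |x_i − q(x)_i| ≤ step for all indices i. Let P_q be any N:M magnitude sparsity mask for q(x) with associated sparsification s_q, and let P be any N:M magnitude sparsity mask for x with associated sparsification s. Then ‖x − s_q(q(x))‖_p ≤ ‖x − q(x)‖_p + ‖x − s(x)‖_p + 2·step·(((M − N)/M)·n)^{1/p}, where the last term is 2·step times the L_p norm of a vector in ℝⁿ having ((M − N)/M)·n entries equal to 1 and the rest equal to 0. -/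
theorem exists_exchange {n : ℕ} (G : Fin n → ℕ) (A B : Finset (Fin n))
    (h : ∀ g, (A.filter fun i => G i = g).card = (B.filter fun i => G i = g).card) :
    ∃ σ : Fin n → Fin n,
      (∀ i ∈ A, σ i = i ∨ (i ∉ B ∧ σ i ∈ B ∧ σ i ∉ A ∧ G (σ i) = G i)) ∧
      ∀ f : Fin n → ℝ, ∑ i ∈ A, f (σ i) = ∑ i ∈ B, f i := by
  classical
  have hc : ∀ g, ((A \ B).filter fun i => G i = g).card
      = ((B \ A).filter fun i => G i = g).card := by
    intro g
    have e1 : ∀ S T : Finset (Fin n), ((S \ T).filter fun i => G i = g)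
        = (S.filter fun i => G i = g) \ (T.filter fun i => G i = g) := by
      intro S T
      ext i
      simp only [Finset.mem_filter, Finset.mem_sdiff]
      tauto
    rw [e1, e1]
    exact Finset.card_sdiff_comm (h g)
  have hF : ∀ g, Nonempty ({a : {i // i ∈ A \ B} // G a.1 = g} ≃
      {b : {i // i ∈ B \ A} // G b.1 = g}) := by
    intro g
    have e2 : ∀ S : Finset (Fin n), Nonempty ({a : {i // i ∈ S} // G a.1 = g} ≃
        {i // i ∈ S.filter fun i => G i = g}) := fun S =>
      ⟨(Equiv.subtypeSubtypeEquivSubtypeInter (fun i => i ∈ S) (fun i => G i = g)).trans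
        (Equiv.subtypeEquivRight (by intro i; simp))⟩
    obtain ⟨a⟩ := e2 (A \ B)
    obtain ⟨b⟩ := e2 (B \ A)
    exact ⟨(a.trans (Finset.equivOfCardEq (hc g))).trans b.symm⟩
  let e : {i // i ∈ A \ B} ≃ {i // i ∈ B \ A} :=
    Equiv.ofFiberEquiv (f := fun a : {i // i ∈ A \ B} => G a.1)
      (g := fun b : {i // i ∈ B \ A} => G b.1) (fun g => (hF g).some)
  have he : ∀ a, G (e a).1 = G a.1 := fun a =>
    Equiv.ofFiberEquiv_map (f := fun a : {i // i ∈ A \ B} => G a.1)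
      (g := fun b : {i // i ∈ B \ A} => G b.1) (fun g => (hF g).some) a
  refine ⟨fun i => if hi : i ∈ A \ B then (e ⟨i, hi⟩).1 else i, ?_, ?_⟩
  · intro i hi
    by_cases hB : i ∈ A \ B
    · right
      have h1 := (e ⟨i, hB⟩).2
      have h2 := he ⟨i, hB⟩
      simp only [dif_pos hB]
      rw [Finset.mem_sdiff] at h1
      exact ⟨(Finset.mem_sdiff.1 hB).2, h1.1, h1.2, h2⟩
    · left
      simp only [dif_neg hB]
  · intro f
    rw [← Finset.sum_inter_add_sum_sdiff A B, ← Finset.sum_inter_add_sum_sdiff B A f,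
      Finset.inter_comm B A]
    congr 1
    · apply Finset.sum_congr rfl
      intro i hi
      have : i ∉ A \ B := by
        simp only [Finset.mem_inter, Finset.mem_sdiff] at hi ⊢
        tauto
      simp only [dif_neg this]
    · rw [← Finset.sum_coe_sort (A \ B), ← Finset.sum_coe_sort (B \ A)]
      rw [← Equiv.sum_comp e]
      apply Finset.sum_congr rfl
      intro i _
      simp only [dif_pos i.2, Subtype.coe_eta]

/-- L_p upper bound for the error of quantization followed by sparsity:
`‖x − s_q(q(x))‖_p ≤ ‖x − q(x)‖_p + ‖x − s(x)‖_p + 2⋅step⋅(((M−N)/M)⋅n)^(1/p)`. -/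
theorem quantize_then_sparsify_Lp_upper_bound
    (n m N M : ℕ) (hn : 0 < n) (hm : 2 ≤ m) (hN : 0 < N) (hNM : N ≤ M) (hMdvd : M ∣ n)
    (p : ℝ) (hp : 1 ≤ p)
    (x : Fin n → ℝ) (step : ℝ) (hstep : 0 ≤ step)
    (hq : ∀ i, |x i - qInt m x i| ≤ step)
    (Pq : Finset (Fin n)) (hPq : IsNMMask N M (qInt m x) Pq)
    (P : Finset (Fin n)) (hP : IsNMMask N M x P) :
    lpNorm p (x - sparsify Pq (qInt m x)) ≤
      lpNorm p (x - qInt m x) + lpNorm p (x - sparsify P x) +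
        2 * step * ((((M : ℝ) - N) / M) * n) ^ (1 / p) := by
  classical
  have hM : 0 < M := by omega
  have hp0 : 0 < p := by linarith
  have hp' : 0 ≤ 1 / p := by positivity
  generalize qInt m x = q at *
  obtain ⟨hc1, ho1⟩ := hPq
  obtain ⟨hc2, ho2⟩ := hP
  have hlt : ∀ i : Fin n, (i : ℕ) / M < n / M := by
    intro i
    obtain ⟨k, rfl⟩ := hMdvd
    rw [Nat.mul_div_cancel_left _ hM]
    exact Nat.div_lt_of_lt_mul i.2
  have hcard : (Pq.card : ℝ) = (((M : ℝ) - N) / M) * n := by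
    have h1 : Pq.card = ∑ g ∈ Finset.range (n / M), (M - N) := by
      rw [Finset.card_eq_sum_card_fiberwise (f := fun i : Fin n => (i : ℕ) / M)
        (t := Finset.range (n / M)) (fun i _ => by simpa using hlt i)]
      exact Finset.sum_congr rfl fun g hg => hc1 g (Finset.mem_range.1 hg)
    have hM' : (M : ℝ) ≠ 0 := by positivity
    rw [h1, Finset.sum_const, Finset.card_range, smul_eq_mul, Nat.cast_mul,
      Nat.cast_div hMdvd hM', Nat.cast_sub hNM]
    ring
  obtain ⟨σ, hσ, hsum⟩ := exists_exchange (fun i : Fin n => (i : ℕ) / M) Pq P (by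
    intro g
    by_cases hg : g < n / M
    · rw [hc1 g hg, hc2 g hg]
    · have e : ∀ S : Finset (Fin n), (S.filter fun i : Fin n => (i : ℕ) / M = g) = ∅ := by
        intro S
        apply Finset.filter_eq_empty_iff.2
        intro i _ h
        exact hg (h ▸ hlt i)
      rw [e, e])
  have hb : ∀ i ∈ Pq, |x i| ≤ |x (σ i)| + 2 * step := by
    intro i hi
    rcases hσ i hi with h | ⟨h1, h2, h3, h4⟩
    · rw [h]; linarith
    · have a := ho1 i hi (σ i) h3 h4.symm
      have b := hq i
      have c := hq (σ i)
      have d := abs_sub_abs_le_abs_sub (x i) (q i)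
      have d' := abs_sub_abs_le_abs_sub (q (σ i)) (x (σ i))
      rw [abs_sub_comm] at d'
      linarith
  have key : (∑ i ∈ Pq, |x i| ^ p) ^ (1 / p) ≤
      (∑ i ∈ P, |x i| ^ p) ^ (1 / p) + 2 * step * (Pq.card : ℝ) ^ (1 / p) := by
    calc (∑ i ∈ Pq, |x i| ^ p) ^ (1 / p)
        ≤ (∑ i ∈ Pq, (|x (σ i)| + 2 * step) ^ p) ^ (1 / p) := by
          apply Real.rpow_le_rpow (Finset.sum_nonneg fun i _ => by positivity) _ hp'
          exact Finset.sum_le_sum fun i hi =>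
            Real.rpow_le_rpow (abs_nonneg _) (hb i hi) hp0.le
      _ ≤ (∑ i ∈ Pq, |x (σ i)| ^ p) ^ (1 / p) + (∑ i ∈ Pq, (2 * step) ^ p) ^ (1 / p) :=
          Real.Lp_add_le_of_nonneg Pq hp (fun i _ => abs_nonneg _) (fun i _ => by positivity)
      _ = _ := by
          rw [hsum (fun i => |x i| ^ p), Finset.sum_const, nsmul_eq_mul,
            Real.mul_rpow (by positivity) (by positivity),
            ← Real.rpow_mul (by positivity : 0 ≤ 2 * step),
            mul_one_div_cancel hp0.ne', Real.rpow_one, mul_comm (2 * step)]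
  have hS : ∀ S : Finset (Fin n), ∑ i, (if i ∈ S then |x i| else 0) ^ p = ∑ i ∈ S, |x i| ^ p := by
    intro S
    rw [← Finset.sum_filter_add_sum_filter_not Finset.univ (fun i => i ∈ S)]
    rw [Finset.sum_eq_zero (s := Finset.univ.filter fun i => i ∉ S)]
    · simp only [Finset.filter_mem_eq_inter, Finset.univ_inter, add_zero]
      exact Finset.sum_congr rfl fun i hi => by rw [if_pos hi]
    · intro i hi
      rw [if_neg (Finset.mem_filter.1 hi).2, Real.zero_rpow hp0.ne']
  have hPn : lpNorm p (x - sparsify P x) = (∑ i ∈ P, |x i| ^ p) ^ (1 / p) := by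
    rw [← hS]
    unfold lpNorm sparsify
    congr 1
    apply Finset.sum_congr rfl
    intro i _
    by_cases hi : i ∈ P <;> simp [hi]
  have first : lpNorm p (x - sparsify Pq q) ≤
      lpNorm p (x - q) + (∑ i ∈ Pq, |x i| ^ p) ^ (1 / p) := by
    rw [← hS]
    unfold lpNorm
    refine le_trans ?_ (Real.Lp_add_le_of_nonneg Finset.univ hp (fun i _ => abs_nonneg _)
      (fun i _ => by split_ifs <;> positivity))
    apply Real.rpow_le_rpow (Finset.sum_nonneg fun i _ => by positivity) _ hp'
    refine Finset.sum_le_sum fun i _ => Real.rpow_le_rpow (abs_nonneg _) ?_ hp0.le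
    by_cases hi : i ∈ Pq <;> simp [hi, sparsify]
  rw [← hcard, hPn]
  linarith
end

section
/- For any maps q, s, c : ℝⁿ → ℝⁿ and any x, w ∈ ℝⁿ, writing ε_f(v) := v − f(v) and ε̃_c(w) := ε_c(w) − ε_q(w) − ε_s(w), the absolute dot-product error of the composition is bounded by the sum of the individual dot-product errors plus two additional error terms: |⟨x, w⟩ − ⟨q(x), c(w)⟩| ≤ |⟨x, w⟩ − ⟨x, s(w)⟩| + |⟨x, w⟩ − ⟨q(x), q(w)⟩| + |⟨q(x), ε̃_c(w)⟩| + |⟨ε_q(x), ε_s(w)⟩|. -/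
/-- The standard dot product on ℝⁿ. -/
def dot {n : ℕ} (u v : Fin n → ℝ) : ℝ := ∑ i, u i * v i

/-- Upper bound for the dot-product error of a composition: with `ε_f(v) = v − f(v)`
and correction vector `ε̃_c(w) = ε_c(w) − ε_q(w) − ε_s(w)`,
`|⟨x,w⟩ − ⟨q(x), c(w)⟩| ≤ |⟨x,w⟩ − ⟨x, s(w)⟩| + |⟨x,w⟩ − ⟨q(x), q(w)⟩|
 + |⟨q(x), ε̃_c(w)⟩| + |⟨ε_q(x), ε_s(w)⟩|`. -/
theorem dot_error_upper_bound
    (n : ℕ) (q s c : (Fin n → ℝ) → (Fin n → ℝ)) (x w : Fin n → ℝ) :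
    |dot x w - dot (q x) (c w)| ≤
      |dot x w - dot x (s w)| + |dot x w - dot (q x) (q w)|
        + |dot (q x) ((w - c w) - (w - q w) - (w - s w))|
        + |dot (x - q x) (w - s w)| := by
  have key : dot x w - dot (q x) (c w) =
      (dot x w - dot x (s w)) + (dot x w - dot (q x) (q w))
        + dot (q x) ((w - c w) - (w - q w) - (w - s w))
        - dot (x - q x) (w - s w) := by
    simp only [dot, ← Finset.sum_sub_distrib, ← Finset.sum_add_distrib, Pi.sub_apply]
    exact Finset.sum_congr rfl fun i _ => by ring
  rw [key]
  refine (abs_sub _ _).trans ?_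
  gcongr
  refine (abs_add_le _ _).trans ?_
  gcongr
  exact abs_add_le _ _
end

section
/- Let n, m, N, M be positive integers with m ≥ 2, N ≤ M and M dividing n. Let q be the max-scaled INT_m quantization on ℝⁿ and let x ∈ ℝⁿ be such that the magnitudes of the components of x are pairwise distinct within each consecutive group of M coordinates, and such that q preserves strict magnitude order within each group (for all i, j in the same group, |x_i| < |x_j| implies |q(x)_i| < |q(x)_j|). Let P be the unique N:M magnitude sparsity mask for x with associated sparsification s. Then P is also a valid N:M magnitude sparsity mask for q(x), and quantization and sparsification commute: q(s(x)) = s_P(q(x)), where s_P denotes zeroing the coordinates in P. In particular ‖x − q(s(x))‖₁ = ‖x − s_P(q(x))‖₁. -/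
theorem exists_retained_aux (n N M : ℕ) (hN : 0 < N) (hNM : N ≤ M) (hMdvd : M ∣ n)
    (x : Fin n → ℝ) (P : Finset (Fin n)) (hP : IsNMMask N M x P) (j : Fin n) :
    ∃ k : Fin n, k ∉ P ∧ |x j| ≤ |x k| := by
  by_cases hj : j ∈ P
  swap
  · exact ⟨j, hj, le_rfl⟩
  by_contra hcon
  have hM : 0 < M := by omega
  have hall : ∀ k : Fin n, (j : ℕ) / M = (k : ℕ) / M → k ∈ P := by
    intro k hk
    by_contra hkP
    exact hcon ⟨k, hkP, hP.2 j hj k hkP hk⟩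
  have hg : (j : ℕ) / M < n / M := by
    obtain ⟨c, rfl⟩ := hMdvd
    rw [Nat.mul_div_cancel_left c hM]
    exact Nat.div_lt_of_lt_mul j.2
  have hcard := hP.1 _ hg
  have hlt : ∀ t : Fin M, M * ((j : ℕ) / M) + t < n := by
    intro t
    obtain ⟨c, rfl⟩ := hMdvd
    rw [Nat.mul_div_cancel_left c hM] at hg
    have := Nat.mul_le_mul_left M (Nat.succ_le_of_lt hg)
    have h2 := t.2
    rw [Nat.mul_succ] at this
    omega
  have hle : (Finset.univ : Finset (Fin M)).card ≤
      (P.filter fun i : Fin n => (i : ℕ) / M = (j : ℕ) / M).card := by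
    apply Finset.card_le_card_of_injOn (fun t : Fin M => (⟨M * ((j : ℕ) / M) + t, hlt t⟩ : Fin n))
    · intro t _
      have h : (M * ((j : ℕ) / M) + (t : ℕ)) / M = (j : ℕ) / M := by
        rw [Nat.mul_add_div hM, Nat.div_eq_of_lt t.2, add_zero]
      simp only [Finset.coe_filter, Set.mem_setOf_eq]
      exact ⟨hall _ h.symm, h⟩
    · intro a _ b _ hab
      simp only [Fin.mk.injEq] at hab
      exact Fin.ext (by omega)
  rw [hcard, Finset.card_univ, Fintype.card_fin] at hle
  omega

theorem iSup_sparsify_aux (n N M : ℕ) (hn : 0 < n) (hN : 0 < N) (hNM : N ≤ M) (hMdvd : M ∣ n)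
    (x : Fin n → ℝ) (P : Finset (Fin n)) (hP : IsNMMask N M x P) :
    (⨆ j, |sparsify P x j|) = ⨆ j, |x j| := by
  haveI : Nonempty (Fin n) := ⟨⟨0, hn⟩⟩
  apply le_antisymm
  · apply ciSup_mono (Set.finite_range _).bddAbove
    intro j
    simp only [sparsify]
    split_ifs
    · simp
    · exact le_rfl
  · apply ciSup_le
    intro j
    obtain ⟨k, hk, hjk⟩ := exists_retained_aux n N M hN hNM hMdvd x P hP j
    refine hjk.trans ?_
    have h := le_ciSup (f := fun j => |sparsify P x j|) (Set.finite_range _).bddAbove k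
    simpa [sparsify, hk] using h

/-- If magnitudes are pairwise distinct within each group and quantization preserves
the strict magnitude order within each group, then the (unique) N:M magnitude mask
`P` for `x` is also a valid mask for `q(x)`, quantization and sparsification
commute, and in particular the two orders have the same L₁ error. -/
theorem quantization_sparsity_commute_no_collisions
    (n m N M : ℕ) (hn : 0 < n) (hm : 2 ≤ m) (hN : 0 < N) (hNM : N ≤ M) (hMdvd : M ∣ n)
    (x : Fin n → ℝ)
    (hdist : ∀ i j : Fin n, i ≠ j → (i : ℕ) / M = (j : ℕ) / M → |x i| ≠ |x j|)
    (hord : ∀ i j : Fin n, (i : ℕ) / M = (j : ℕ) / M → |x i| < |x j| →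
      |qInt m x i| < |qInt m x j|)
    (P : Finset (Fin n)) (hP : IsNMMask N M x P) :
    IsNMMask N M (qInt m x) P ∧
    qInt m (sparsify P x) = sparsify P (qInt m x) ∧
    lpNorm 1 (x - qInt m (sparsify P x)) = lpNorm 1 (x - sparsify P (qInt m x)) := by
  have hq : qInt m (sparsify P x) = sparsify P (qInt m x) := by
    funext i
    simp only [qInt, iSup_sparsify_aux n N M hn hN hNM hMdvd x P hP]
    by_cases hi : i ∈ P
    · simp [sparsify, hi]
    · simp [sparsify, hi, qInt]
  refine ⟨⟨hP.1, ?_⟩, hq, by rw [hq]⟩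
  intro i hi j hj hij
  have hne : i ≠ j := fun h => hj (h ▸ hi)
  exact (hord i j hij (lt_of_le_of_ne (hP.2 i hi j hj hij) (hdist i j hne hij))).le
end

section
/- Let n, m, N, M be positive integers with m ≥ 2, N ≤ M and M dividing n. Let q be the max-scaled INT_m quantization on ℝⁿ and let x ∈ ℝⁿ. Let P be any N:M magnitude sparsity mask for x with associated sparsification s, and let P_q be any N:M magnitude sparsity mask for q(x) with associated sparsification s_q. Then applying sparsity before quantization is optimal in L₁: ‖x − q(s(x))‖₁ ≤ ‖x − s_q(q(x))‖₁. -/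
lemma aux_sum {ι : Type*} [DecidableEq ι] (f : ι → ℝ) (A B : Finset ι) (hc : A.card = B.card)
    (h : ∀ a ∈ A, ∀ b ∈ B, a ∉ B → b ∉ A → f a ≤ f b) : ∑ i ∈ A, f i ≤ ∑ i ∈ B, f i := by
  have h1 := Finset.sum_sdiff_sub_sum_sdiff (s₁ := A) (s₂ := B) (f := f)
  have hc2 : (A \ B).card = (B \ A).card := by
    have := Finset.card_sdiff_add_card_inter A B
    have := Finset.card_sdiff_add_card_inter B A
    rw [Finset.inter_comm B A] at this
    omega
  suffices ∑ i ∈ A \ B, f i ≤ ∑ i ∈ B \ A, f i by linarith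
  rcases (A \ B).eq_empty_or_nonempty with h0 | h0
  · rw [h0] at hc2 ⊢
    rw [Finset.card_empty] at hc2
    rw [Finset.card_eq_zero.mp hc2.symm]
  · obtain ⟨a, ha, hmax⟩ := Finset.exists_max_image (A \ B) f h0
    have e1 := Finset.sum_le_card_nsmul (A \ B) f (f a) hmax
    have e2 := Finset.card_nsmul_le_sum (B \ A) f (f a) (by
      intro b hb
      rw [Finset.mem_sdiff] at ha hb
      exact h a ha.1 b hb.1 ha.2 hb.2)
    rw [hc2] at e1
    exact e1.trans e2

lemma aux_mono (s t : ℝ) (h : |s| ≤ |t|) :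
    |s| - |s - round s| ≤ |t| - |t - round t| := by
  have a1 := round_le t (round s)
  have a2 := round_le t (-round s)
  push_cast at a2
  have key : |t - round s| ≤ |s - round s| + (|t| - |s|) ∨
      |t - -(round s : ℝ)| ≤ |s - round s| + (|t| - |s|) := by
    generalize (round s : ℝ) = r
    grind
  rcases key with k | k <;> linarith

lemma aux_mono' (d s t : ℝ) (hd : 0 ≤ d) (h : |s| ≤ |t|) :
    |s| - |s - d * round (s / d)| ≤ |t| - |t - d * round (t / d)| := by
  rcases hd.eq_or_lt with rfl | hd
  · simp
  · have h2 : |s / d| ≤ |t / d| := by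
      rw [abs_div, abs_div]; gcongr
    have key := aux_mono _ _ h2
    have e : ∀ u : ℝ, |u| - |u - d * round (u / d)| = d * (|u / d| - |u / d - round (u / d)|) := by
      intro u
      have h3 : u - d * round (u / d) = d * (u / d - round (u / d)) := by field_simp
      rw [h3, abs_mul, abs_of_pos hd, abs_div, abs_of_pos hd]
      field_simp
    rw [e, e]
    gcongr

lemma aux_retained (n N M : ℕ) (hN : 0 < N) (hNM : N ≤ M) (hMdvd : M ∣ n)
    (P : Finset (Fin n))
    (hP : ∀ g : ℕ, g < n / M → (P.filter fun i : Fin n => (i : ℕ) / M = g).card = M - N)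
    (i : Fin n) : ∃ j : Fin n, j ∉ P ∧ (i : ℕ) / M = (j : ℕ) / M := by
  by_contra! hcon
  have hg : (i : ℕ) / M < n / M := Nat.div_lt_div_of_lt_of_dvd hMdvd i.2
  have hc := hP _ hg
  have hM : 0 < M := by omega
  have hlt : ∀ k : Fin M, ((i : ℕ) / M) * M + k < n := by
    intro k
    obtain ⟨c, rfl⟩ := hMdvd
    rw [Nat.mul_div_cancel_left _ hM] at hg
    have := k.2
    nlinarith
  have hle : (Finset.univ.image (fun k : Fin M => (⟨((i : ℕ) / M) * M + k, hlt k⟩ : Fin n))).card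
      ≤ (P.filter fun j : Fin n => (j : ℕ) / M = (i : ℕ) / M).card := by
    apply Finset.card_le_card
    intro j hj
    obtain ⟨k, -, rfl⟩ := Finset.mem_image.mp hj
    have e : (((i : ℕ) / M) * M + k) / M = (i : ℕ) / M := by
      rw [add_comm, Nat.add_mul_div_right _ _ hM, Nat.div_eq_of_lt k.2, zero_add]
    rw [Finset.mem_filter]
    refine ⟨?_, e⟩
    by_contra hk
    exact hcon _ hk e.symm
  rw [Finset.card_image_of_injective, Finset.card_univ, Fintype.card_fin] at hle
  · omega
  · intro a b hab
    simp only [Fin.mk.injEq] at hab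
    ext; omega

/-- Sparsity before quantization is optimal in L₁:
`‖x − q(s(x))‖₁ ≤ ‖x − s_q(q(x))‖₁` for any N:M magnitude masks `P` for `x`
and `P_q` for `q(x)`. -/
theorem sparsity_before_quantization_optimal_L1
    (n m N M : ℕ) (hn : 0 < n) (hm : 2 ≤ m) (hN : 0 < N) (hNM : N ≤ M) (hMdvd : M ∣ n)
    (x : Fin n → ℝ)
    (P : Finset (Fin n)) (hP : IsNMMask N M x P)
    (Pq : Finset (Fin n)) (hPq : IsNMMask N M (qInt m x) Pq) :
    lpNorm 1 (x - qInt m (sparsify P x)) ≤ lpNorm 1 (x - sparsify Pq (qInt m x)) := by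
  have hb : ∀ v : Fin n → ℝ, BddAbove (Set.range fun j => |v j|) :=
    fun v => (Set.finite_range _).bddAbove
  haveI : Nonempty (Fin n) := ⟨⟨0, hn⟩⟩
  have hsup : (⨆ j, |sparsify P x j|) = ⨆ j, |x j| := by
    apply le_antisymm
    · apply ciSup_le
      intro j
      refine le_trans ?_ (le_ciSup (hb x) j)
      unfold sparsify
      split_ifs <;> simp
    · apply ciSup_le
      intro j
      obtain ⟨k, hk, hjk⟩ := aux_retained n N M hN hNM hMdvd P hP.1 j
      by_cases hj : j ∈ P
      · refine le_trans (hP.2 j hj k hk hjk) ?_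
        have := le_ciSup (hb (sparsify P x)) k
        simpa [sparsify, hk] using this
      · have := le_ciSup (hb (sparsify P x)) j
        simpa [sparsify, hj] using this
  obtain ⟨d, hdd⟩ : ∃ d : ℝ, d = (⨆ j, |x j|) / ((2 : ℝ) ^ (m - 1) - 1) := ⟨_, rfl⟩
  have hd : 0 ≤ d := by
    rw [hdd]
    apply div_nonneg (Real.iSup_nonneg fun j => abs_nonneg _)
    have := one_le_pow₀ (one_le_two (α := ℝ)) (n := m - 1)
    linarith
  have hq : ∀ i, qInt m x i = d * round (x i / d) := by
    intro i; simp only [qInt, hdd]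
  have hqs : ∀ i, qInt m (sparsify P x) i = if i ∈ P then 0 else d * (round (x i / d) : ℝ) := by
    intro i
    simp only [qInt, hsup, ← hdd]
    by_cases hi : i ∈ P <;> simp [sparsify, hi]
  set f : Fin n → ℝ := fun i => |x i| - |x i - d * round (x i / d)| with hf
  have hsum : ∀ Q : Finset (Fin n),
      ∑ i, |x i - if i ∈ Q then 0 else d * (round (x i / d) : ℝ)|
        = ∑ i, |x i - d * round (x i / d)| + ∑ i ∈ Q, f i := by
    intro Q
    have e : ∑ i ∈ Q, f i = ∑ i, if i ∈ Q then f i else 0 := by simp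
    rw [e, ← Finset.sum_add_distrib]
    apply Finset.sum_congr rfl
    intro i _
    by_cases hi : i ∈ Q <;> simp [hi, hf]
  have hmain : ∑ i ∈ P, f i ≤ ∑ i ∈ Pq, f i := by
    have hmap : ∀ Q : Finset (Fin n), ∀ i ∈ Q, (i : ℕ) / M ∈ Finset.range (n / M) := by
      intro Q i _
      exact Finset.mem_range.mpr (Nat.div_lt_div_of_lt_of_dvd hMdvd i.2)
    rw [← Finset.sum_fiberwise_of_maps_to (hmap P), ← Finset.sum_fiberwise_of_maps_to (hmap Pq)]
    apply Finset.sum_le_sum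
    intro g hg
    rw [Finset.mem_range] at hg
    apply aux_sum
    · rw [hP.1 g hg, hPq.1 g hg]
    · intro a ha b hb' _ hbn
      rw [Finset.mem_filter] at ha hb'
      have hbP : b ∉ P := fun h => hbn (Finset.mem_filter.mpr ⟨h, hb'.2⟩)
      exact aux_mono' d _ _ hd (hP.2 a ha.1 b hbP (ha.2.trans hb'.2.symm))
  simp only [lpNorm, Real.rpow_one, div_one, Pi.sub_apply, hqs]
  simp only [sparsify, hq]
  rw [hsum, hsum]
  linarith
end
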